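/- Let α ∈ [0, π/2), let A, B ∈ M_n(ℂ) be sector matrices of angle α, and let 1 ≤ k ≤ n. Then ∏_{j=1}^{k} s_j(I_n + (A+B)^{-1}) ≤ sec^{2k}(α) · ∏_{j=1}^{k} s_j(I_n + (sec²(α)/4)·A^{-1}) · ∏_{j=1}^{k} s_j(I_n + (sec²(α)/4)·B^{-1}). -/

import Mathlib

open Matrix
open scoped ComplexOrder

/-- The real (Hermitian) part of a complex matrix: `Re A = (A + Aᴴ)/2`. -/
noncomputable def matRe {n : ℕ} (A : Matrix (Fin n) (Fin n) ℂ) : Matrix (Fin n) (Fin n) ℂ :=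
  (2⁻¹ : ℂ) • (A + Aᴴ)

/-- `A` is a sector matrix of angle `α`: its numerical range is contained in
`S_α = {z : Re z > 0, |Im z| ≤ tan α · Re z}`. -/
def InSector {n : ℕ} (α : ℝ) (A : Matrix (Fin n) (Fin n) ℂ) : Prop :=
  ∀ x : Fin n → ℂ, star x ⬝ᵥ x = 1 →
    0 < (star x ⬝ᵥ A *ᵥ x).re ∧
      |(star x ⬝ᵥ A *ᵥ x).im| ≤ Real.tan α * (star x ⬝ᵥ A *ᵥ x).re

/-- The `j`-th largest singular value of `X` (eigenvalues of `(XᴴX)^{1/2}` in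
decreasing order): `sval X 0 ≥ sval X 1 ≥ …`. -/
noncomputable def sval {n : ℕ} (X : Matrix (Fin n) (Fin n) ℂ) (j : Fin n) : ℝ :=
  Real.sqrt ((Matrix.posSemidef_conjTranspose_mul_self X).1.eigenvalues
    (Tuple.sort (Matrix.posSemidef_conjTranspose_mul_self X).1.eigenvalues j.rev))


/-! Elementary facts on the standard sesquilinear form -/

theorem aux_conj {n : ℕ} (x y : Fin n → ℂ) : star (star x ⬝ᵥ y) = star y ⬝ᵥ x := by
  rw [← Matrix.star_dotProduct_star, star_star]

theorem aux_adj {n : ℕ} (A : Matrix (Fin n) (Fin n) ℂ) (x y : Fin n → ℂ) :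
    star x ⬝ᵥ (A *ᵥ y) = star (Aᴴ *ᵥ x) ⬝ᵥ y := by
  rw [Matrix.star_mulVec, Matrix.conjTranspose_conjTranspose, Matrix.dotProduct_mulVec]

theorem aux_nrm {n : ℕ} (x : Fin n → ℂ) : (star x ⬝ᵥ x).re = ∑ i, ‖x i‖ ^ 2 := by
  simp only [dotProduct, Complex.re_sum, Pi.star_apply]
  refine Finset.sum_congr rfl fun i _ => ?_
  rw [← Complex.normSq_eq_norm_sq, Complex.normSq_apply]
  simp

theorem aux_nrm_nonneg {n : ℕ} (x : Fin n → ℂ) : 0 ≤ (star x ⬝ᵥ x).re := by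
  rw [aux_nrm]; positivity

theorem aux_nrm_pos {n : ℕ} {x : Fin n → ℂ} (hx : x ≠ 0) : 0 < (star x ⬝ᵥ x).re := by
  rw [aux_nrm]
  obtain ⟨i, hi⟩ := Function.ne_iff.1 hx
  refine Finset.sum_pos' (fun i _ => by positivity) ⟨i, Finset.mem_univ _, ?_⟩
  have : 0 < ‖x i‖ := norm_pos_iff.2 hi
  positivity

theorem aux_cs {n : ℕ} (x y : Fin n → ℂ) :
    ‖star x ⬝ᵥ y‖ ^ 2 ≤ (star x ⬝ᵥ x).re * (star y ⬝ᵥ y).re := by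
  have h := norm_inner_le_norm (𝕜 := ℂ) (WithLp.toLp 2 x) (WithLp.toLp 2 y)
  rw [EuclideanSpace.inner_toLp_toLp, dotProduct_comm] at h
  have h2 := pow_le_pow_left₀ (norm_nonneg _) h 2
  rwa [mul_pow, EuclideanSpace.norm_sq_eq, EuclideanSpace.norm_sq_eq, ← aux_nrm, ← aux_nrm] at h2

theorem aux_nrm_im {n : ℕ} (x : Fin n → ℂ) : (star x ⬝ᵥ x).im = 0 := by
  have h := congrArg Complex.im (aux_conj x x)
  simp at h
  linarith

theorem aux_herm_im {n : ℕ} {H : Matrix (Fin n) (Fin n) ℂ} (hH : H.IsHermitian) (x : Fin n → ℂ) :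
    (star x ⬝ᵥ H *ᵥ x).im = 0 := by
  have h := congrArg Complex.im (aux_conj x (H *ᵥ x))
  rw [aux_adj H x x, hH.eq] at h
  simp at h
  rw [aux_adj H x x, hH.eq]
  linarith

theorem aux_psd {n : ℕ} {H : Matrix (Fin n) (Fin n) ℂ} (hH : H.IsHermitian)
    (h : ∀ x, 0 ≤ (star x ⬝ᵥ H *ᵥ x).re) : H.PosSemidef := by
  refine Matrix.PosSemidef.of_dotProduct_mulVec_nonneg hH fun x => ?_
  rw [Complex.le_def]
  exact ⟨h x, (aux_herm_im hH x).symm⟩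

open scoped MatrixOrder Matrix.Norms.L2Operator in
theorem aux_factor {n : ℕ} {H : Matrix (Fin n) (Fin n) ℂ} (hH : H.IsHermitian)
    (h : ∀ x, 0 ≤ (star x ⬝ᵥ H *ᵥ x).re) : ∃ W : Matrix (Fin n) (Fin n) ℂ, H = Wᴴ * W := by
  obtain ⟨W, hW⟩ := CStarAlgebra.nonneg_iff_eq_star_mul_self.1 (aux_psd hH h).nonneg
  exact ⟨W, hW⟩

/-- Cauchy-Schwarz for a positive semidefinite form. -/
theorem aux_cs_psd {n : ℕ} {H : Matrix (Fin n) (Fin n) ℂ} (hH : H.IsHermitian)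
    (h : ∀ x, 0 ≤ (star x ⬝ᵥ H *ᵥ x).re) (x y : Fin n → ℂ) :
    ‖star x ⬝ᵥ H *ᵥ y‖ ^ 2 ≤ (star x ⬝ᵥ H *ᵥ x).re * (star y ⬝ᵥ H *ᵥ y).re := by
  obtain ⟨W, rfl⟩ := aux_factor hH h
  have key : ∀ a b : Fin n → ℂ, star a ⬝ᵥ (Wᴴ * W) *ᵥ b = star (W *ᵥ a) ⬝ᵥ (W *ᵥ b) := by
    intro a b
    rw [← Matrix.mulVec_mulVec, aux_adj, Matrix.conjTranspose_conjTranspose]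
  rw [key, key, key]
  exact aux_cs _ _

/-! Sorted eigenvalues -/

/-- eigenvalues of a Hermitian matrix in decreasing order -/
noncomputable def lamS {n : ℕ} {H : Matrix (Fin n) (Fin n) ℂ} (hH : H.IsHermitian) (j : Fin n) : ℝ :=
  hH.eigenvalues (Tuple.sort hH.eigenvalues j.rev)

theorem lamS_antitone {n : ℕ} {H : Matrix (Fin n) (Fin n) ℂ} (hH : H.IsHermitian) :
    Antitone (lamS hH) := by
  intro i j hij
  exact Tuple.monotone_sort hH.eigenvalues (Fin.rev_le_rev.2 hij)

theorem lamS_spec {n : ℕ} {H : Matrix (Fin n) (Fin n) ℂ} (hH : H.IsHermitian) :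
    ∃ U : Matrix (Fin n) (Fin n) ℂ, Uᴴ * U = 1 ∧ U * Uᴴ = 1 ∧
      H = Uᴴ * diagonal (fun i => (lamS hH i : ℂ)) * U := by
  let σ : Equiv.Perm (Fin n) := Fin.revPerm.trans (Tuple.sort hH.eigenvalues)
  let E : Matrix (Fin n) (Fin n) ℂ := hH.eigenvectorUnitary
  have hE : E * Eᴴ = 1 := Unitary.mul_star_self_of_mem hH.eigenvectorUnitary.2
  have hE' : Eᴴ * E = 1 := Unitary.star_mul_self_of_mem hH.eigenvectorUnitary.2
  have hs : H = E * diagonal (fun i => (hH.eigenvalues i : ℂ)) * Eᴴ := by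
    have := hH.spectral_theorem
    rw [Unitary.conjStarAlgAut_apply] at this
    exact this
  refine ⟨Eᴴ.submatrix σ id, ?_, ?_, ?_⟩
  · rw [conjTranspose_submatrix, conjTranspose_conjTranspose, Matrix.submatrix_mul_equiv, hE]
    simp
  · rw [conjTranspose_submatrix, conjTranspose_conjTranspose, ← Equiv.coe_refl, Matrix.submatrix_mul_equiv, hE']
    simp
  · have hd : diagonal (fun i => (lamS hH i : ℂ)) =
        (diagonal (fun i => (hH.eigenvalues i : ℂ))).submatrix σ σ := by
      rw [Matrix.submatrix_diagonal _ _ σ.injective]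
      rfl
    rw [hd, conjTranspose_submatrix, conjTranspose_conjTranspose, Matrix.submatrix_mul_equiv,
      Matrix.submatrix_mul_equiv, ← hs]
    simp

theorem form_diag {n : ℕ} (U : Matrix (Fin n) (Fin n) ℂ) (d : Fin n → ℝ) (x : Fin n → ℂ) :
    (star x ⬝ᵥ (Uᴴ * diagonal (fun i => (d i : ℂ)) * U) *ᵥ x).re
      = ∑ i, d i * ‖(U *ᵥ x) i‖ ^ 2 := by
  rw [← Matrix.mulVec_mulVec, ← Matrix.mulVec_mulVec, aux_adj, Matrix.conjTranspose_conjTranspose]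
  simp only [dotProduct, Complex.re_sum, Pi.star_apply, Matrix.mulVec_diagonal]
  refine Finset.sum_congr rfl fun i _ => ?_
  rw [← Complex.normSq_eq_norm_sq, Complex.normSq_apply]
  simp
  ring

theorem nrm_unitary {n : ℕ} {U : Matrix (Fin n) (Fin n) ℂ} (hU : Uᴴ * U = 1) (x : Fin n → ℂ) :
    (star x ⬝ᵥ x).re = ∑ i, ‖(U *ᵥ x) i‖ ^ 2 := by
  rw [← aux_nrm, aux_adj, Matrix.mulVec_mulVec, hU, Matrix.one_mulVec]

theorem det_diag {n : ℕ} {U : Matrix (Fin n) (Fin n) ℂ} (hU : Uᴴ * U = 1) (d : Fin n → ℝ) :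
    (Uᴴ * diagonal (fun i => (d i : ℂ)) * U).det = ((∏ i, d i : ℝ) : ℂ) := by
  rw [Matrix.det_mul, Matrix.det_mul, mul_right_comm, ← Matrix.det_mul, hU, Matrix.det_diagonal]
  simp

theorem finrank_vanish {n : ℕ} (U : Matrix (Fin n) (Fin n) ℂ) (S : Finset (Fin n)) :
    ∃ N : Submodule ℂ (Fin n → ℂ), n ≤ S.card + Module.finrank ℂ N ∧
      ∀ v ∈ N, ∀ i ∈ S, (U *ᵥ v) i = 0 := by
  let f : (Fin n → ℂ) →ₗ[ℂ] (S → ℂ) := LinearMap.funLeft ℂ ℂ (Subtype.val) ∘ₗ Matrix.mulVecLin U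
  refine ⟨LinearMap.ker f, ?_, ?_⟩
  · have h := LinearMap.finrank_range_add_finrank_ker f
    have h2 := Submodule.finrank_le (LinearMap.range f)
    simp at h h2
    omega
  · intro v hv i hi
    exact congrFun (LinearMap.mem_ker.1 hv) ⟨i, hi⟩

/-- upper spectral subspace -/
theorem lamS_low {n : ℕ} {H : Matrix (Fin n) (Fin n) ℂ} (hH : H.IsHermitian) (j : Fin n) :
    ∃ N : Submodule ℂ (Fin n → ℂ), n ≤ j + Module.finrank ℂ N ∧
      ∀ v ∈ N, (star v ⬝ᵥ H *ᵥ v).re ≤ lamS hH j * (star v ⬝ᵥ v).re := by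
  obtain ⟨U, h1, h2, h3⟩ := lamS_spec hH
  obtain ⟨N, hN, hv⟩ := finrank_vanish U (Finset.Iio j)
  refine ⟨N, by simpa using hN, fun v hvN => ?_⟩
  have hf := form_diag U (lamS hH) v
  rw [← h3] at hf
  rw [hf, nrm_unitary h1, Finset.mul_sum]
  refine Finset.sum_le_sum fun i _ => ?_
  by_cases hi : i < j
  · rw [hv v hvN i (by simpa using hi)]; simp
  · exact mul_le_mul_of_nonneg_right (lamS_antitone hH (not_lt.1 hi)) (by positivity)

theorem lamS_high {n : ℕ} {H : Matrix (Fin n) (Fin n) ℂ} (hH : H.IsHermitian) (j : Fin n) :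
    ∃ N : Submodule ℂ (Fin n → ℂ), j + 1 ≤ Module.finrank ℂ N ∧
      ∀ v ∈ N, lamS hH j * (star v ⬝ᵥ v).re ≤ (star v ⬝ᵥ H *ᵥ v).re := by
  obtain ⟨U, h1, h2, h3⟩ := lamS_spec hH
  obtain ⟨N, hN, hv⟩ := finrank_vanish U (Finset.Ioi j)
  refine ⟨N, by have := j.2; simp at hN; omega, fun v hvN => ?_⟩
  have hf := form_diag U (lamS hH) v
  rw [← h3] at hf
  rw [hf, nrm_unitary h1, Finset.mul_sum]
  refine Finset.sum_le_sum fun i _ => ?_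
  by_cases hi : j < i
  · rw [hv v hvN i (by simpa using hi)]; simp
  · exact mul_le_mul_of_nonneg_right (lamS_antitone hH (not_lt.1 hi)) (by positivity)

theorem lamS_le {n : ℕ} {H : Matrix (Fin n) (Fin n) ℂ} (hH : H.IsHermitian) (j : Fin n) (c : ℝ)
    (N : Submodule ℂ (Fin n → ℂ)) (hN : n ≤ j + Module.finrank ℂ N)
    (h : ∀ v ∈ N, (star v ⬝ᵥ H *ᵥ v).re ≤ c * (star v ⬝ᵥ v).re) : lamS hH j ≤ c := by
  obtain ⟨M, hM, hMv⟩ := lamS_high hH j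
  have hne : N ⊓ M ≠ ⊥ := by
    intro hbot
    have h1 := Submodule.finrank_sup_add_finrank_inf_eq N M
    have h2 := Submodule.finrank_le (N ⊔ M)
    rw [hbot] at h1
    simp at h1 h2
    omega
  obtain ⟨v, hv, hv0⟩ := Submodule.exists_mem_ne_zero_of_ne_bot hne
  have := (hMv v hv.2).trans (h v hv.1)
  exact le_of_mul_le_mul_right this (aux_nrm_pos hv0)

theorem lamS_mono {n : ℕ} {H K : Matrix (Fin n) (Fin n) ℂ} (hH : H.IsHermitian)
    (hK : K.IsHermitian) (c : ℝ) (hc : 0 ≤ c)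
    (h : ∀ v, (star v ⬝ᵥ H *ᵥ v).re ≤ c * (star v ⬝ᵥ K *ᵥ v).re) (j : Fin n) :
    lamS hH j ≤ c * lamS hK j := by
  obtain ⟨N, hN, hv⟩ := lamS_low hK j
  refine lamS_le hH j _ N hN fun v hvN => ?_
  rw [mul_assoc]
  exact (h v).trans (mul_le_mul_of_nonneg_left (hv v hvN) hc)

theorem le_lamS {n : ℕ} {H : Matrix (Fin n) (Fin n) ℂ} (hH : H.IsHermitian) (c : ℝ)
    (h : ∀ v, c * (star v ⬝ᵥ v).re ≤ (star v ⬝ᵥ H *ᵥ v).re) (j : Fin n) : c ≤ lamS hH j := by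
  obtain ⟨N, hN, hv⟩ := lamS_low hH j
  have hne : N ≠ ⊥ := by
    rintro rfl
    have := j.2
    simp at hN
    omega
  obtain ⟨v, hv', hv0⟩ := Submodule.exists_mem_ne_zero_of_ne_bot hne
  have := (h v).trans (hv v hv')
  exact le_of_mul_le_mul_right this (aux_nrm_pos hv0)

theorem det_lamS {n : ℕ} {H : Matrix (Fin n) (Fin n) ℂ} (hH : H.IsHermitian) :
    H.det.re = ∏ i, lamS hH i := by
  obtain ⟨U, h1, h2, h3⟩ := lamS_spec hH
  have := det_diag h1 (lamS hH)
  rw [← h3] at this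
  rw [this, Complex.ofReal_re]

theorem det_lamS' {n : ℕ} {H : Matrix (Fin n) (Fin n) ℂ} (hH : H.IsHermitian) :
    H.det = ((∏ i, lamS hH i : ℝ) : ℂ) := by
  obtain ⟨U, h1, h2, h3⟩ := lamS_spec hH
  have := det_diag h1 (lamS hH)
  rwa [← h3] at this

theorem inv_form {n : ℕ} {A : Matrix (Fin n) (Fin n) ℂ} (hA : IsUnit A) (x : Fin n → ℂ) :
    star x ⬝ᵥ A⁻¹ *ᵥ x = star (star (A⁻¹ *ᵥ x) ⬝ᵥ A *ᵥ (A⁻¹ *ᵥ x)) := by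
  have h : A *ᵥ (A⁻¹ *ᵥ x) = x := by
    rw [Matrix.mulVec_mulVec, Matrix.mul_nonsing_inv _ ((Matrix.isUnit_iff_isUnit_det _).1 hA),
      Matrix.one_mulVec]
  rw [h, aux_conj]

theorem isUnit_of_pos {n : ℕ} {A : Matrix (Fin n) (Fin n) ℂ}
    (h : ∀ x, x ≠ 0 → 0 < (star x ⬝ᵥ A *ᵥ x).re) : IsUnit A := by
  rw [Matrix.isUnit_iff_isUnit_det, isUnit_iff_ne_zero]
  intro h0
  obtain ⟨v, hv, hv0⟩ := Matrix.exists_mulVec_eq_zero_iff.2 h0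
  have := h v hv
  rw [hv0] at this
  simp at this

theorem det_sub {n : ℕ} {G R : Matrix (Fin n) (Fin n) ℂ} (hG : G.IsHermitian) (hR : R.IsHermitian)
    (hG1 : ∀ x, (star x ⬝ᵥ x).re ≤ (star x ⬝ᵥ G *ᵥ x).re)
    (hR0 : ∀ x, 0 ≤ (star x ⬝ᵥ R *ᵥ x).re) :
    (G + R).det.re ≤ G.det.re * (1 + R).det.re := by
  obtain ⟨W, rfl⟩ := aux_factor hR hR0
  have hu : IsUnit G := isUnit_of_pos fun x hx => (aux_nrm_pos hx).trans_le (hG1 x)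
  have hGi : G * G⁻¹ = 1 := Matrix.mul_nonsing_inv _ ((Matrix.isUnit_iff_isUnit_det _).1 hu)
  have hK : (1 + W * (G⁻¹ * Wᴴ)).IsHermitian := by
    rw [Matrix.IsHermitian, conjTranspose_add, conjTranspose_mul, conjTranspose_mul,
      conjTranspose_conjTranspose, conjTranspose_nonsing_inv, hG.eq, conjTranspose_one, mul_assoc]
  have hL : (1 + W * Wᴴ).IsHermitian := by
    rw [Matrix.IsHermitian, conjTranspose_add, conjTranspose_mul,
      conjTranspose_conjTranspose, conjTranspose_one]
  have e1 : G + Wᴴ * W = G * (1 + (G⁻¹ * Wᴴ) * W) := by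
    rw [mul_add, mul_one, ← mul_assoc, ← mul_assoc, hGi, one_mul]
  have hform : ∀ x, star x ⬝ᵥ (W * (G⁻¹ * Wᴴ)) *ᵥ x = star (Wᴴ *ᵥ x) ⬝ᵥ G⁻¹ *ᵥ (Wᴴ *ᵥ x) := by
    intro x
    rw [← Matrix.mulVec_mulVec, aux_adj, ← Matrix.mulVec_mulVec]
  have hform2 : ∀ x, star x ⬝ᵥ (W * Wᴴ) *ᵥ x = star (Wᴴ *ᵥ x) ⬝ᵥ (Wᴴ *ᵥ x) := by
    intro x
    rw [← Matrix.mulVec_mulVec, aux_adj]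
  have hinv0 : ∀ x, 0 ≤ (star x ⬝ᵥ G⁻¹ *ᵥ x).re := by
    intro x
    rw [inv_form hu]
    exact (aux_nrm_nonneg _).trans (hG1 _)
  have hinv1 : ∀ x, (star x ⬝ᵥ G⁻¹ *ᵥ x).re ≤ (star x ⬝ᵥ x).re := by
    intro x
    have h0 := hinv0 x
    have h1 : (star (G⁻¹ *ᵥ x) ⬝ᵥ (G⁻¹ *ᵥ x)).re ≤ (star x ⬝ᵥ G⁻¹ *ᵥ x).re := by
      rw [inv_form hu x]
      exact hG1 _
    have h2 := aux_cs x (G⁻¹ *ᵥ x)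
    have h3 : (star x ⬝ᵥ G⁻¹ *ᵥ x).re ^ 2 ≤ ‖star x ⬝ᵥ G⁻¹ *ᵥ x‖ ^ 2 := by
      rw [← sq_abs]
      exact pow_le_pow_left₀ (abs_nonneg _) (Complex.abs_re_le_norm _) 2
    have h4 := aux_nrm_nonneg x
    nlinarith
  have e2 : (G + Wᴴ * W).det.re = G.det.re * ∏ i, lamS hK i := by
    rw [e1, Matrix.det_mul, Matrix.det_one_add_mul_comm, det_lamS' hK, det_lamS' hG,
      Complex.re_ofReal_mul, Complex.ofReal_re, Complex.ofReal_re]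
  have e3 : (1 + Wᴴ * W).det.re = ∏ i, lamS hL i := by
    rw [Matrix.det_one_add_mul_comm, det_lamS' hL, Complex.ofReal_re]
  rw [e2, e3]
  refine mul_le_mul_of_nonneg_left ?_ ?_
  · refine Finset.prod_le_prod (fun i _ => ?_) (fun i _ => ?_)
    · refine le_lamS hK 0 (fun v => ?_) i
      rw [Matrix.add_mulVec, dotProduct_add, Matrix.one_mulVec, Complex.add_re, hform]
      have := hinv0 (Wᴴ *ᵥ v)
      have := aux_nrm_nonneg v
      linarith
    · rw [← one_mul (lamS hL i)]
      refine lamS_mono hK hL 1 zero_le_one (fun v => ?_) i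
      rw [Matrix.add_mulVec, dotProduct_add, Matrix.one_mulVec, Complex.add_re, hform,
        Matrix.add_mulVec, dotProduct_add, Matrix.one_mulVec, Complex.add_re, hform2]
      have := hinv1 (Wᴴ *ᵥ v)
      linarith
  · rw [det_lamS hG]
    refine Finset.prod_nonneg fun i _ => le_lamS hG 0 (fun v => ?_) i
    have := hG1 v
    have := aux_nrm_nonneg v
    linarith

theorem exists_G {n : ℕ} {P : Matrix (Fin n) (Fin n) ℂ} (hP : P.IsHermitian)
    (hP1 : ∀ x, (star x ⬝ᵥ x).re ≤ (star x ⬝ᵥ P *ᵥ x).re)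
    {k : ℕ} (hk1 : 1 ≤ k) (hkn : k ≤ n) :
    ∃ (μ : ℝ) (G : Matrix (Fin n) (Fin n) ℂ), 1 ≤ μ ∧ G.IsHermitian ∧
      (∀ x, (star x ⬝ᵥ x).re ≤ (star x ⬝ᵥ G *ᵥ x).re) ∧
      (∀ x, (star x ⬝ᵥ P *ᵥ x).re ≤ μ * (star x ⬝ᵥ G *ᵥ x).re) ∧
      μ ^ k * G.det.re = ∏ j ∈ Finset.univ.filter (fun j : Fin n => (j : ℕ) < k), lamS hP j := by
  obtain ⟨U, h1, h2, h3⟩ := lamS_spec hP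
  set j0 : Fin n := ⟨k - 1, by omega⟩ with hj0
  set μ := lamS hP j0 with hμ
  have hμ1 : 1 ≤ μ := le_lamS hP 1 (fun v => by rw [one_mul]; exact hP1 v) j0
  have hμ0 : 0 < μ := by linarith
  let d : Fin n → ℝ := fun i => max (lamS hP i / μ) 1
  refine ⟨μ, Uᴴ * diagonal (fun i => (d i : ℂ)) * U, hμ1, ?_, ?_, ?_, ?_⟩
  · rw [Matrix.IsHermitian, conjTranspose_mul, conjTranspose_mul, conjTranspose_conjTranspose,
      diagonal_conjTranspose, mul_assoc]
    congr 3
    ext i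
    simp
  · intro x
    rw [form_diag, nrm_unitary h1]
    refine Finset.sum_le_sum fun i _ => ?_
    exact le_mul_of_one_le_left (by positivity) (le_max_right _ _)
  · intro x
    have hf := form_diag U (lamS hP) x
    rw [← h3] at hf
    rw [hf, form_diag, Finset.mul_sum]
    refine Finset.sum_le_sum fun i _ => ?_
    rw [← mul_assoc]
    refine mul_le_mul_of_nonneg_right ?_ (by positivity)
    have : lamS hP i / μ ≤ d i := le_max_left _ _
    rw [div_le_iff₀ hμ0] at this
    linarith
  · rw [det_diag h1, Complex.ofReal_re]
    have hcard : (Finset.univ.filter (fun j : Fin n => (j : ℕ) < k)).card = k := by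
      rw [Fin.card_filter_val_lt]; omega
    have hs : ∏ i, d i = ∏ j ∈ Finset.univ.filter (fun j : Fin n => (j : ℕ) < k), d j := by
      symm
      refine Finset.prod_subset (Finset.subset_univ _) fun i _ hi => ?_
      simp only [Finset.mem_filter, Finset.mem_univ, true_and, not_lt] at hi
      refine max_eq_right ?_
      rw [div_le_one hμ0]
      refine lamS_antitone hP ?_
      rw [Fin.le_def]; simp [hj0]; omega
    have hs2 : μ ^ k = ∏ j ∈ Finset.univ.filter (fun j : Fin n => (j : ℕ) < k), μ := by
      rw [Finset.prod_const, hcard]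
    rw [hs, hs2, ← Finset.prod_mul_distrib]
    refine Finset.prod_congr rfl fun i hi => ?_
    simp only [Finset.mem_filter, Finset.mem_univ, true_and] at hi
    have : μ ≤ lamS hP i := by
      refine lamS_antitone hP ?_
      rw [Fin.le_def]; simp [hj0]; omega
    have hd : d i = lamS hP i / μ := max_eq_left ((one_le_div hμ0).2 this)
    rw [hd]
    field_simp

theorem prod_key {n : ℕ} {P Q : Matrix (Fin n) (Fin n) ℂ} (hP : P.IsHermitian) (hQ : Q.IsHermitian)
    (hP1 : ∀ x, (star x ⬝ᵥ x).re ≤ (star x ⬝ᵥ P *ᵥ x).re)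
    (hQ1 : ∀ x, (star x ⬝ᵥ x).re ≤ (star x ⬝ᵥ Q *ᵥ x).re)
    {T : Matrix (Fin n) (Fin n) ℂ} (hT : T.IsHermitian)
    (hT0 : ∀ x, 0 ≤ (star x ⬝ᵥ T *ᵥ x).re)
    (hTPQ : ∀ x, (star x ⬝ᵥ T *ᵥ x).re ≤
      (star x ⬝ᵥ P *ᵥ x).re + (star x ⬝ᵥ Q *ᵥ x).re - (star x ⬝ᵥ x).re)
    {k : ℕ} (hk1 : 1 ≤ k) (hkn : k ≤ n) :
    ∏ j ∈ Finset.univ.filter (fun j : Fin n => (j : ℕ) < k), lamS hT j ≤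
      (∏ j ∈ Finset.univ.filter (fun j : Fin n => (j : ℕ) < k), lamS hP j) *
      ∏ j ∈ Finset.univ.filter (fun j : Fin n => (j : ℕ) < k), lamS hQ j := by
  obtain ⟨μ, G, hμ, hG, hG1, hPG, hGd⟩ := exists_G hP hP1 hk1 hkn
  obtain ⟨ν, F, hν, hF, hF1, hQF, hFd⟩ := exists_G hQ hQ1 hk1 hkn
  have hR : (F - 1).IsHermitian := hF.sub Matrix.isHermitian_one
  have hR0 : ∀ x, (star x ⬝ᵥ (F - 1) *ᵥ x).re = (star x ⬝ᵥ F *ᵥ x).re - (star x ⬝ᵥ x).re := by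
    intro x
    rw [Matrix.sub_mulVec, dotProduct_sub, Matrix.one_mulVec, Complex.sub_re]
  have hdet := det_sub hG hR hG1 (fun x => by rw [hR0]; have := hF1 x; linarith)
  rw [add_sub_cancel] at hdet
  have hK : (G + (F - 1)).IsHermitian := hG.add hR
  have hKf : ∀ x, (star x ⬝ᵥ (G + (F - 1)) *ᵥ x).re =
      (star x ⬝ᵥ G *ᵥ x).re + (star x ⬝ᵥ F *ᵥ x).re - (star x ⬝ᵥ x).re := by
    intro x
    rw [Matrix.add_mulVec, dotProduct_add, Complex.add_re, hR0]; ring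
  have hcard : (Finset.univ.filter (fun j : Fin n => (j : ℕ) < k)).card = k := by
    rw [Fin.card_filter_val_lt]; omega
  have hK1 : ∀ j, 1 ≤ lamS hK j := le_lamS hK 1 fun v => by
    rw [hKf]
    have := hG1 v
    have := hF1 v
    linarith
  have hmn : 0 ≤ μ * ν := by positivity
  have s1 : ∀ j, lamS hT j ≤ (μ * ν) * lamS hK j := by
    refine lamS_mono hT hK _ hmn fun v => ?_
    rw [hKf]
    have a1 := hTPQ v
    have a2 := hPG v
    have a3 := hQF v
    have a4 := hG1 v
    have a5 := hF1 v
    have a6 := aux_nrm_nonneg v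
    have b1 := mul_nonneg (mul_nonneg (by linarith : 0 ≤ μ) (by linarith : 0 ≤ ν - 1)) (sub_nonneg.2 a4)
    have b2 := mul_nonneg (mul_nonneg (by linarith : 0 ≤ ν) (by linarith : 0 ≤ μ - 1)) (sub_nonneg.2 a5)
    have b3 := mul_nonneg (mul_nonneg (by linarith : 0 ≤ ν - 1) (by linarith : 0 ≤ μ - 1)) a6
    nlinarith
  calc _ ≤ ∏ j ∈ Finset.univ.filter (fun j : Fin n => (j : ℕ) < k), (μ * ν) * lamS hK j :=
        Finset.prod_le_prod (fun i _ => le_lamS hT 0 (fun v => by rw [zero_mul]; exact hT0 v) i)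
          (fun i _ => s1 i)
    _ = (μ * ν) ^ k * ∏ j ∈ Finset.univ.filter (fun j : Fin n => (j : ℕ) < k), lamS hK j := by
        rw [Finset.prod_mul_distrib, Finset.prod_const, hcard]
    _ ≤ (μ * ν) ^ k * ∏ j, lamS hK j := by
        refine mul_le_mul_of_nonneg_left ?_ (by positivity)
        exact Finset.prod_le_prod_of_subset_of_one_le (Finset.subset_univ _)
          (fun i _ => zero_le_one.trans (hK1 i)) (fun i _ _ => hK1 i)
    _ ≤ (μ * ν) ^ k * (G.det.re * F.det.re) := by
        refine mul_le_mul_of_nonneg_left ?_ (by positivity)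
        rw [← det_lamS hK]; exact hdet
    _ = _ := by rw [← hGd, ← hFd, mul_pow]; ring

/-! Sector matrices -/

theorem matRe_herm {n : ℕ} (A : Matrix (Fin n) (Fin n) ℂ) : (matRe A).IsHermitian := by
  rw [matRe, Matrix.IsHermitian, conjTranspose_smul, conjTranspose_add, conjTranspose_conjTranspose,
    add_comm]
  simp

theorem matRe_form {n : ℕ} (A : Matrix (Fin n) (Fin n) ℂ) (x : Fin n → ℂ) :
    (star x ⬝ᵥ matRe A *ᵥ x).re = (star x ⬝ᵥ A *ᵥ x).re := by
  have h : star x ⬝ᵥ Aᴴ *ᵥ x = star (star x ⬝ᵥ A *ᵥ x) := by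
    rw [aux_conj, aux_adj Aᴴ, conjTranspose_conjTranspose]
  rw [matRe, Matrix.smul_mulVec, dotProduct_smul, Matrix.add_mulVec, dotProduct_add, h]
  simp [Complex.mul_re]
  ring

/-- homogeneous version of the sector condition -/
def SecT {n : ℕ} (t : ℝ) (A : Matrix (Fin n) (Fin n) ℂ) : Prop :=
  ∀ x : Fin n → ℂ, (x ≠ 0 → 0 < (star x ⬝ᵥ A *ᵥ x).re) ∧
      |(star x ⬝ᵥ A *ᵥ x).im| ≤ t * (star x ⬝ᵥ A *ᵥ x).re

theorem InSector.secT {n : ℕ} {α : ℝ} {A : Matrix (Fin n) (Fin n) ℂ} (h : InSector α A) :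
    SecT (Real.tan α) A := by
  intro x
  by_cases hx : x = 0
  · subst hx; simp
  have hp := aux_nrm_pos hx
  set N := (star x ⬝ᵥ x).re with hN
  have hNc : star x ⬝ᵥ x = (N : ℂ) := by
    apply Complex.ext <;> simp [hN, aux_nrm_im]
  set c : ℝ := (Real.sqrt N)⁻¹ with hc
  have hcc : c * c = N⁻¹ := by
    rw [hc, ← mul_inv, Real.mul_self_sqrt hp.le]
  have hsc : ∀ M : Matrix (Fin n) (Fin n) ℂ,
      star ((c : ℂ) • x) ⬝ᵥ M *ᵥ ((c : ℂ) • x) = ((N⁻¹ : ℝ) : ℂ) * (star x ⬝ᵥ M *ᵥ x) := by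
    intro M
    rw [Matrix.mulVec_smul, dotProduct_smul, star_smul, smul_dotProduct, smul_eq_mul, smul_eq_mul,
      ← mul_assoc, ← hcc]
    simp
  have h1 : star ((c : ℂ) • x) ⬝ᵥ ((c : ℂ) • x) = 1 := by
    have := hsc 1
    rw [Matrix.one_mulVec, Matrix.one_mulVec, hNc, ← Complex.ofReal_mul, inv_mul_cancel₀ hp.ne'] at this
    simpa using this
  obtain ⟨ha, hb⟩ := h _ h1
  have hi : 0 < N⁻¹ := inv_pos.2 hp
  rw [hsc, Complex.re_ofReal_mul] at ha hb
  rw [Complex.im_ofReal_mul, abs_mul, abs_of_pos hi, mul_left_comm] at hb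
  exact ⟨fun _ => pos_of_mul_pos_right ha hi.le, le_of_mul_le_mul_left hb hi⟩

theorem SecT.nonneg {n : ℕ} {t : ℝ} {A : Matrix (Fin n) (Fin n) ℂ} (h : SecT t A) (x : Fin n → ℂ) :
    0 ≤ (star x ⬝ᵥ A *ᵥ x).re := by
  by_cases hx : x = 0
  · subst hx; simp
  · exact ((h x).1 hx).le

theorem SecT.isUnit {n : ℕ} {t : ℝ} {A : Matrix (Fin n) (Fin n) ℂ} (h : SecT t A) : IsUnit A :=
  isUnit_of_pos fun x hx => (h x).1 hx

theorem SecT.add {n : ℕ} {t : ℝ} {A B : Matrix (Fin n) (Fin n) ℂ} (hA : SecT t A)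
    (hB : SecT t B) : SecT t (A + B) := by
  intro x
  rw [Matrix.add_mulVec, dotProduct_add, Complex.add_re, Complex.add_im]
  refine ⟨fun hx => add_pos ((hA x).1 hx) ((hB x).1 hx), ?_⟩
  have := abs_add_le (star x ⬝ᵥ A *ᵥ x).im (star x ⬝ᵥ B *ᵥ x).im
  have h1 := (hA x).2
  have h2 := (hB x).2
  linarith

theorem SecT.one {n : ℕ} {t : ℝ} (ht : 0 ≤ t) : SecT t (1 : Matrix (Fin n) (Fin n) ℂ) := by
  intro x
  rw [Matrix.one_mulVec, aux_nrm_im, abs_zero]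
  exact ⟨fun hx => aux_nrm_pos hx, mul_nonneg ht (aux_nrm_nonneg x)⟩

theorem SecT.inv {n : ℕ} {t : ℝ} {A : Matrix (Fin n) (Fin n) ℂ} (h : SecT t A) : SecT t A⁻¹ := by
  intro x
  rw [inv_form h.isUnit]
  have hh := h (A⁻¹ *ᵥ x)
  refine ⟨fun hx => ?_, ?_⟩
  · refine hh.1 fun h0 => hx ?_
    have : A *ᵥ (A⁻¹ *ᵥ x) = x := by
      rw [Matrix.mulVec_mulVec, Matrix.mul_nonsing_inv _
        ((Matrix.isUnit_iff_isUnit_det _).1 h.isUnit), Matrix.one_mulVec]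
    rw [← this, h0, Matrix.mulVec_zero]
  · simpa using hh.2

/-- A Hermitian form dominated by a positive one -/
theorem herm_dom {n : ℕ} {R S : Matrix (Fin n) (Fin n) ℂ} (hR : R.IsHermitian) (hS : S.IsHermitian)
    {t : ℝ} (h : ∀ x, |(star x ⬝ᵥ S *ᵥ x).re| ≤ t * (star x ⬝ᵥ R *ᵥ x).re) (x y : Fin n → ℂ) :
    ‖star x ⬝ᵥ S *ᵥ y‖ ^ 2 ≤ t ^ 2 * ((star x ⬝ᵥ R *ᵥ x).re * (star y ⬝ᵥ R *ᵥ y).re) := by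
  have htR : ((t : ℂ) • R).IsHermitian := by
    rw [Matrix.IsHermitian, conjTranspose_smul, hR.eq]; simp
  have hp : ∀ a b, star a ⬝ᵥ ((t : ℂ) • R + S) *ᵥ b
      = t * (star a ⬝ᵥ R *ᵥ b) + star a ⬝ᵥ S *ᵥ b := by
    intro a b
    rw [Matrix.add_mulVec, dotProduct_add, Matrix.smul_mulVec, dotProduct_smul, smul_eq_mul]
  have hm : ∀ a b, star a ⬝ᵥ ((t : ℂ) • R - S) *ᵥ b
      = t * (star a ⬝ᵥ R *ᵥ b) - star a ⬝ᵥ S *ᵥ b := by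
    intro a b
    rw [Matrix.sub_mulVec, dotProduct_sub, Matrix.smul_mulVec, dotProduct_smul, smul_eq_mul]
  have hp0 : ∀ a, 0 ≤ (star a ⬝ᵥ ((t : ℂ) • R + S) *ᵥ a).re := by
    intro a
    rw [hp, Complex.add_re, Complex.re_ofReal_mul]
    have := (abs_le.1 (h a)).1
    linarith
  have hm0 : ∀ a, 0 ≤ (star a ⬝ᵥ ((t : ℂ) • R - S) *ᵥ a).re := by
    intro a
    rw [hm, Complex.sub_re, Complex.re_ofReal_mul]
    have := (abs_le.1 (h a)).2
    linarith
  have c1 := aux_cs_psd (htR.add hS) hp0 x y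
  have c2 := aux_cs_psd (htR.sub hS) hm0 x y
  have px := hp0 x
  have py := hp0 y
  have mx := hm0 x
  have my := hm0 y
  have sx : (star x ⬝ᵥ ((t : ℂ) • R + S) *ᵥ x).re + (star x ⬝ᵥ ((t : ℂ) • R - S) *ᵥ x).re
      = 2 * (t * (star x ⬝ᵥ R *ᵥ x).re) := by
    rw [hp, hm, Complex.sub_re, Complex.add_re, Complex.re_ofReal_mul]; ring
  have sy : (star y ⬝ᵥ ((t : ℂ) • R + S) *ᵥ y).re + (star y ⬝ᵥ ((t : ℂ) • R - S) *ᵥ y).re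
      = 2 * (t * (star y ⬝ᵥ R *ᵥ y).re) := by
    rw [hp, hm, Complex.sub_re, Complex.add_re, Complex.re_ofReal_mul]; ring
  have hn : 2 * ‖star x ⬝ᵥ S *ᵥ y‖ ≤ ‖star x ⬝ᵥ ((t : ℂ) • R + S) *ᵥ y‖ +
      ‖star x ⬝ᵥ ((t : ℂ) • R - S) *ᵥ y‖ := by
    have := norm_sub_le (star x ⬝ᵥ ((t : ℂ) • R + S) *ᵥ y) (star x ⬝ᵥ ((t : ℂ) • R - S) *ᵥ y)
    have e : star x ⬝ᵥ ((t : ℂ) • R + S) *ᵥ y - star x ⬝ᵥ ((t : ℂ) • R - S) *ᵥ y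
        = 2 * (star x ⬝ᵥ S *ᵥ y) := by
      rw [hp, hm]; ring
    rw [e, norm_mul] at this
    simpa using this
  have n0 := norm_nonneg (star x ⬝ᵥ S *ᵥ y)
  have n1 := norm_nonneg (star x ⬝ᵥ ((t : ℂ) • R + S) *ᵥ y)
  have n2 := norm_nonneg (star x ⬝ᵥ ((t : ℂ) • R - S) *ᵥ y)
  have hr : t ^ 2 * ((star x ⬝ᵥ R *ᵥ x).re * (star y ⬝ᵥ R *ᵥ y).re)
     = (2 * (t * (star x ⬝ᵥ R *ᵥ x).re)) * (2 * (t * (star y ⬝ᵥ R *ᵥ y).re)) / 4 := by ring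
  rw [hr, ← sx, ← sy]
  generalize (star x ⬝ᵥ ((t : ℂ) • R + S) *ᵥ x).re = p at *
  generalize (star y ⬝ᵥ ((t : ℂ) • R + S) *ᵥ y).re = p' at *
  generalize (star x ⬝ᵥ ((t : ℂ) • R - S) *ᵥ x).re = m at *
  generalize (star y ⬝ᵥ ((t : ℂ) • R - S) *ᵥ y).re = m' at *
  generalize ‖star x ⬝ᵥ ((t : ℂ) • R + S) *ᵥ y‖ = a at *
  generalize ‖star x ⬝ᵥ ((t : ℂ) • R - S) *ᵥ y‖ = b at *
  generalize ‖star x ⬝ᵥ S *ᵥ y‖ = c at *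
  have hab : 2 * (a * b) ≤ p * m' + p' * m := by
    refine (le_abs_self _).trans (abs_le_of_sq_le_sq ?_ (by positivity))
    have : (a ^ 2) * (b ^ 2) ≤ (p * p') * (m * m') := mul_le_mul c1 c2 (by positivity) (by positivity)
    nlinarith [sq_nonneg (p * m' - p' * m)]
  have : (2 * c) ^ 2 ≤ (a + b) ^ 2 := pow_le_pow_left₀ (by positivity) hn 2
  nlinarith

theorem SecT.cs {n : ℕ} {t : ℝ} {A : Matrix (Fin n) (Fin n) ℂ} (h : SecT t A) (y u : Fin n → ℂ) :
    ‖star y ⬝ᵥ A *ᵥ u‖ ^ 2 ≤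
      (1 + t ^ 2) * ((star y ⬝ᵥ A *ᵥ y).re * (star u ⬝ᵥ A *ᵥ u).re) := by
  set R := matRe A with hR
  set S : Matrix (Fin n) (Fin n) ℂ := (-(2⁻¹ * Complex.I)) • (A - Aᴴ) with hS
  have hRh : R.IsHermitian := matRe_herm A
  have hSh : S.IsHermitian := by
    rw [hS, Matrix.IsHermitian, conjTranspose_smul, conjTranspose_sub, conjTranspose_conjTranspose,
      ← neg_sub A, smul_neg, ← neg_smul]
    simp
  have hA : A = R + Complex.I • S := by
    rw [hR, hS, matRe, smul_smul]
    have : Complex.I * -(2⁻¹ * Complex.I) = 2⁻¹ := by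
      rw [mul_neg, mul_left_comm, Complex.I_mul_I]; ring
    rw [this, ← smul_add]
    ext i j
    simp
    ring
  have hRp : ∀ x, (star x ⬝ᵥ R *ᵥ x).re = (star x ⬝ᵥ A *ᵥ x).re := matRe_form A
  have hSp : ∀ x, (star x ⬝ᵥ S *ᵥ x).re = (star x ⬝ᵥ A *ᵥ x).im := by
    intro x
    conv_rhs => rw [hA, Matrix.add_mulVec, dotProduct_add, Matrix.smul_mulVec Complex.I S,
      dotProduct_smul, smul_eq_mul, Complex.add_im, aux_herm_im hRh, Complex.I_mul_im, zero_add]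
  have hRu : IsUnit R := isUnit_of_pos fun x hx => by rw [hRp]; exact (h x).1 hx
  have hRn : ∀ x, 0 ≤ (star x ⬝ᵥ R *ᵥ x).re := fun x => by rw [hRp]; exact h.nonneg x
  have hdom := herm_dom hRh hSh (t := t) (fun x => by rw [hRp, hSp]; exact (h x).2)
  set z := R⁻¹ *ᵥ (S *ᵥ u) with hz
  have hRz : R *ᵥ z = S *ᵥ u := by
    rw [hz, Matrix.mulVec_mulVec, Matrix.mul_nonsing_inv _
      ((Matrix.isUnit_iff_isUnit_det _).1 hRu), Matrix.one_mulVec]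
  have hzr : (star z ⬝ᵥ R *ᵥ z).re ≤ t ^ 2 * (star u ⬝ᵥ R *ᵥ u).re := by
    have h1 := hdom z u
    rw [← hRz] at h1
    have h2 : (star z ⬝ᵥ R *ᵥ z).re ^ 2 ≤ ‖star z ⬝ᵥ R *ᵥ z‖ ^ 2 := by
      rw [← sq_abs]
      exact pow_le_pow_left₀ (abs_nonneg _) (Complex.abs_re_le_norm _) 2
    have h3 := hRn z
    have h4 := hRn u
    by_contra hc
    push Not at hc
    have h5 : 0 < (star z ⬝ᵥ R *ᵥ z).re := lt_of_le_of_lt (by positivity) hc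
    nlinarith
  have hAu : A *ᵥ u = R *ᵥ (u + Complex.I • z) := by
    rw [Matrix.mulVec_add, Matrix.mulVec_smul, hRz]
    conv_lhs => rw [hA]
    rw [Matrix.add_mulVec, Matrix.smul_mulVec]
  have hp : (star (u + Complex.I • z) ⬝ᵥ R *ᵥ (u + Complex.I • z)).re =
      (star u ⬝ᵥ R *ᵥ u).re + (star z ⬝ᵥ R *ᵥ z).re := by
    have e1 : star z ⬝ᵥ R *ᵥ u = star u ⬝ᵥ S *ᵥ u := by
      rw [aux_adj, hRh.eq, hRz, aux_adj S, hSh.eq]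
    have e2 := aux_herm_im hSh u
    rw [Matrix.mulVec_add, Matrix.mulVec_smul, dotProduct_add, dotProduct_smul, star_add, star_smul,
      add_dotProduct, add_dotProduct, smul_dotProduct, smul_dotProduct, e1, hRz]
    simp [e2]
  have hcs := aux_cs_psd hRh hRn y (u + Complex.I • z)
  rw [hp, ← hAu] at hcs
  rw [← hRp y, ← hRp u]
  have := mul_le_mul_of_nonneg_left hzr (hRn y)
  linarith

theorem real_ineq {a b p q c : ℝ} (ha : 0 < a) (hb : 0 < b) (hc : 0 < c)
    (h1 : (a + b) ^ 2 ≤ c * (a * p)) (h2 : (a + b) ^ 2 ≤ c * (b * q)) :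
    a + b ≤ c / 4 * (p + q) := by
  have h3 : (a + b) ^ 2 / a ≤ c * p := by rw [div_le_iff₀ ha]; linarith
  have h4 : (a + b) ^ 2 / b ≤ c * q := by rw [div_le_iff₀ hb]; linarith
  have h5 : 4 * (a + b) ≤ (a + b) ^ 2 / a + (a + b) ^ 2 / b := by
    rw [div_add_div _ _ ha.ne' hb.ne', le_div_iff₀ (by positivity)]
    nlinarith [mul_nonneg (by positivity : 0 ≤ a + b) (sq_nonneg (a - b))]
  linarith

theorem SecT.inv_add {n : ℕ} {t : ℝ} {A B : Matrix (Fin n) (Fin n) ℂ} (hA : SecT t A)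
    (hB : SecT t B) (x : Fin n → ℂ) :
    (star x ⬝ᵥ (A + B)⁻¹ *ᵥ x).re ≤
      (1 + t ^ 2) / 4 * ((star x ⬝ᵥ A⁻¹ *ᵥ x).re + (star x ⬝ᵥ B⁻¹ *ᵥ x).re) := by
  by_cases hx : x = 0
  · subst hx; simp
  have hu := (hA.add hB).isUnit
  have back : ∀ M : Matrix (Fin n) (Fin n) ℂ, IsUnit M → M *ᵥ (M⁻¹ *ᵥ x) = x := by
    intro M hM
    rw [Matrix.mulVec_mulVec, Matrix.mul_nonsing_inv _
      ((Matrix.isUnit_iff_isUnit_det _).1 hM), Matrix.one_mulVec]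
  have hy0 : (A + B)⁻¹ *ᵥ x ≠ 0 := by
    intro h0
    have := back _ hu
    rw [h0, Matrix.mulVec_zero] at this
    exact hx this.symm
  have c1 := hA.cs ((A + B)⁻¹ *ᵥ x) (A⁻¹ *ᵥ x)
  have c2 := hB.cs ((A + B)⁻¹ *ᵥ x) (B⁻¹ *ᵥ x)
  rw [back A hA.isUnit] at c1
  rw [back B hB.isUnit] at c2
  have hr : (star ((A + B)⁻¹ *ᵥ x) ⬝ᵥ x).re =
      (star ((A + B)⁻¹ *ᵥ x) ⬝ᵥ A *ᵥ ((A + B)⁻¹ *ᵥ x)).re +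
      (star ((A + B)⁻¹ *ᵥ x) ⬝ᵥ B *ᵥ ((A + B)⁻¹ *ᵥ x)).re := by
    rw [← Complex.add_re, ← dotProduct_add, ← Matrix.add_mulVec, back _ hu]
  have hre : (star ((A + B)⁻¹ *ᵥ x) ⬝ᵥ x).re ^ 2 ≤ ‖star ((A + B)⁻¹ *ᵥ x) ⬝ᵥ x‖ ^ 2 := by
    rw [← sq_abs]
    exact pow_le_pow_left₀ (abs_nonneg _) (Complex.abs_re_le_norm _) 2
  rw [hr] at hre
  have := real_ineq ((hA _).1 hy0) ((hB _).1 hy0) (by positivity) (hre.trans c1) (hre.trans c2)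
  rw [inv_form hu, inv_form hA.isUnit, inv_form hB.isUnit, Matrix.add_mulVec A B, dotProduct_add,
    back A hA.isUnit, back B hB.isUnit]
  simpa using this

theorem sval_eq {n : ℕ} (X : Matrix (Fin n) (Fin n) ℂ) (j : Fin n) :
    sval X j = Real.sqrt (lamS (Matrix.posSemidef_conjTranspose_mul_self X).1 j) := rfl

theorem form_self {n : ℕ} (X : Matrix (Fin n) (Fin n) ℂ) (x : Fin n → ℂ) :
    star x ⬝ᵥ (Xᴴ * X) *ᵥ x = star (X *ᵥ x) ⬝ᵥ (X *ᵥ x) := by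
  rw [← Matrix.mulVec_mulVec, aux_adj, Matrix.conjTranspose_conjTranspose]

theorem lamS_le_sval {n : ℕ} (X : Matrix (Fin n) (Fin n) ℂ) (j : Fin n) :
    lamS (matRe_herm X) j ≤ sval X j := by
  obtain ⟨N, hN, hv⟩ := lamS_low (Matrix.posSemidef_conjTranspose_mul_self X).1 j
  refine lamS_le _ j _ N hN fun v hvN => ?_
  have h0 : 0 ≤ lamS (Matrix.posSemidef_conjTranspose_mul_self X).1 j :=
    le_lamS _ 0 (fun v => by rw [form_self, zero_mul]; exact aux_nrm_nonneg _) j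
  have h1 := hv v hvN
  rw [form_self, ← Real.sq_sqrt h0, ← sval_eq] at h1
  have hs : 0 ≤ sval X j := Real.sqrt_nonneg _
  have h2 := aux_cs v (X *ᵥ v)
  have h3 : (star v ⬝ᵥ X *ᵥ v).re ^ 2 ≤ ‖star v ⬝ᵥ X *ᵥ v‖ ^ 2 := by
    rw [← sq_abs]
    exact pow_le_pow_left₀ (abs_nonneg _) (Complex.abs_re_le_norm _) 2
  have h4 := aux_nrm_nonneg v
  rw [matRe_form]
  refine (le_abs_self _).trans (abs_le_of_sq_le_sq ?_ (by positivity))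
  have := mul_le_mul_of_nonneg_left h1 h4
  nlinarith

theorem SecT.sval_le {n : ℕ} {t : ℝ} {T : Matrix (Fin n) (Fin n) ℂ} (h : SecT t T) (j : Fin n) :
    sval T j ≤ (1 + t ^ 2) * lamS (matRe_herm T) j := by
  have h0 : 0 ≤ lamS (matRe_herm T) j :=
    le_lamS _ 0 (fun v => by rw [matRe_form, zero_mul]; exact h.nonneg v) j
  rw [sval_eq]
  refine Real.sqrt_le_iff.2 ⟨by positivity, ?_⟩
  obtain ⟨M, hM, hv⟩ := lamS_low (matRe_herm T) j
  have hinj : Function.Injective T.mulVec := Matrix.mulVec_injective_iff_isUnit.2 h.isUnit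
  let e : (Fin n → ℂ) ≃ₗ[ℂ] (Fin n → ℂ) := LinearEquiv.ofInjectiveEndo (Matrix.mulVecLin T) hinj
  have he : ∀ v, e v = T *ᵥ v := fun v => rfl
  refine lamS_le _ j _ (M.map (e.symm : (Fin n → ℂ) →ₗ[ℂ] (Fin n → ℂ)))
    (by rw [LinearEquiv.finrank_map_eq]; exact hM) ?_
  rintro _ ⟨w, hw, rfl⟩
  set v : Fin n → ℂ := e.symm w with hvdef
  have hTv : T *ᵥ v = w := by rw [← he, hvdef, LinearEquiv.apply_symm_apply]
  change (star v ⬝ᵥ (Tᴴ * T) *ᵥ v).re ≤ _ * (star v ⬝ᵥ v).re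
  rw [form_self, hTv]
  have h1 := hv w hw
  rw [matRe_form] at h1
  have h2 := h.cs w v
  rw [hTv] at h2
  have h3 := aux_cs v w
  have h4 : (star v ⬝ᵥ w).re ^ 2 ≤ ‖star v ⬝ᵥ w‖ ^ 2 := by
    rw [← sq_abs]
    exact pow_le_pow_left₀ (abs_nonneg _) (Complex.abs_re_le_norm _) 2
  have h5 : (star w ⬝ᵥ w).re ^ 2 ≤ ‖star w ⬝ᵥ w‖ ^ 2 := by
    rw [← sq_abs]
    exact pow_le_pow_left₀ (abs_nonneg _) (Complex.abs_re_le_norm _) 2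
  have h6 := aux_nrm_nonneg v
  have h7 : 0 ≤ (star v ⬝ᵥ w).re := by rw [← hTv]; exact h.nonneg v
  have h8 := h4.trans h3
  have h9 := h5.trans h2
  have h10 := h.nonneg w
  rcases (aux_nrm_nonneg w).eq_or_lt with hw0 | hw0
  · rw [← hw0]; positivity
  have hcpos : (0 : ℝ) < 1 + t ^ 2 := by positivity
  generalize (1 + t ^ 2) = c at *
  generalize (star w ⬝ᵥ w).re = W at *
  generalize (star v ⬝ᵥ v).re = V at *
  generalize (star v ⬝ᵥ w).re = r at *
  generalize (star w ⬝ᵥ T *ᵥ w).re = q at *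
  generalize lamS (matRe_herm T) j = μ at *
  -- W^2 ≤ c q r, q ≤ μ W, r^2 ≤ V W
  have k1 : W ≤ c * μ * r := by
    have : W * W ≤ (c * μ * r) * W := by
      have := mul_le_mul_of_nonneg_left (mul_le_mul_of_nonneg_right h1 h7) hcpos.le
      nlinarith
    exact le_of_mul_le_mul_right this hw0
  have k2 : W ^ 2 ≤ (c * μ * r) ^ 2 := pow_le_pow_left₀ hw0.le k1 2
  have k3 : W * W ≤ ((c * μ) ^ 2 * V) * W := by
    have := mul_le_mul_of_nonneg_left h8 (sq_nonneg (c * μ))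
    nlinarith
  exact le_of_mul_le_mul_right k3 hw0

/-- For sector matrices `A, B` of angle `α ∈ [0, π/2)` and `1 ≤ k ≤ n`,
`∏_{j=1}^k s_j(I + (A+B)⁻¹) ≤ sec^{2k}(α) ∏_{j=1}^k s_j(I + (sec²α/4)A⁻¹) ∏_{j=1}^k s_j(I + (sec²α/4)B⁻¹)`. -/
theorem stmt3 {n : ℕ} {α : ℝ} (hα : α ∈ Set.Ico 0 (Real.pi / 2))
    {A B : Matrix (Fin n) (Fin n) ℂ} (hA : InSector α A) (hB : InSector α B)
    {k : ℕ} (hk1 : 1 ≤ k) (hkn : k ≤ n) :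
    ∏ j ∈ Finset.univ.filter (fun j : Fin n => (j : ℕ) < k), sval (1 + (A + B)⁻¹) j ≤
      (Real.cos α)⁻¹ ^ (2 * k) *
        ((∏ j ∈ Finset.univ.filter (fun j : Fin n => (j : ℕ) < k),
            sval (1 + ((Real.cos α)⁻¹ ^ 2 / 4) • A⁻¹) j) *
          ∏ j ∈ Finset.univ.filter (fun j : Fin n => (j : ℕ) < k),
            sval (1 + ((Real.cos α)⁻¹ ^ 2 / 4) • B⁻¹) j) := by
  have hcos : 0 < Real.cos α := Real.cos_pos_of_mem_Ioo ⟨by linarith [hα.1, Real.pi_pos], hα.2⟩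
  have ht : 0 ≤ Real.tan α := Real.tan_nonneg_of_nonneg_of_le_pi_div_two hα.1 hα.2.le
  have hc : (Real.cos α)⁻¹ ^ 2 = 1 + Real.tan α ^ 2 := by
    rw [inv_pow, ← Real.inv_one_add_tan_sq hcos.ne', inv_inv]
  rw [pow_mul, hc]
  have sA := hA.secT
  have sB := hB.secT
  generalize Real.tan α = t at *
  have sT : SecT t (1 + (A + B)⁻¹) := (SecT.one ht).add (sA.add sB).inv
  have hcpos : (0 : ℝ) < 1 + t ^ 2 := by positivity
  have hform : ∀ (M : Matrix (Fin n) (Fin n) ℂ) (x : Fin n → ℂ),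
      (star x ⬝ᵥ matRe (1 + ((1 + t ^ 2) / 4) • M⁻¹) *ᵥ x).re =
        (star x ⬝ᵥ x).re + (1 + t ^ 2) / 4 * (star x ⬝ᵥ M⁻¹ *ᵥ x).re := by
    intro M x
    rw [matRe_form, Matrix.add_mulVec, dotProduct_add, Matrix.one_mulVec, Matrix.smul_mulVec,
      dotProduct_smul, Complex.add_re, Complex.smul_re, smul_eq_mul]
  have h1 : ∀ M : Matrix (Fin n) (Fin n) ℂ, SecT t M → ∀ x, (star x ⬝ᵥ x).re ≤
      (star x ⬝ᵥ matRe (1 + ((1 + t ^ 2) / 4) • M⁻¹) *ᵥ x).re := by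
    intro M hM x
    rw [hform]
    have := hM.inv.nonneg x
    have : 0 ≤ (1 + t ^ 2) / 4 * (star x ⬝ᵥ M⁻¹ *ᵥ x).re := by positivity
    linarith
  have hcard : (Finset.univ.filter (fun j : Fin n => (j : ℕ) < k)).card = k := by
    rw [Fin.card_filter_val_lt]; omega
  have hlam0 : ∀ M : Matrix (Fin n) (Fin n) ℂ, SecT t M → ∀ j,
      0 ≤ lamS (matRe_herm (1 + ((1 + t ^ 2) / 4) • M⁻¹)) j := by
    intro M hM
    refine le_lamS _ 0 fun v => ?_
    rw [zero_mul]
    exact (aux_nrm_nonneg v).trans (h1 M hM v)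
  have key := prod_key (matRe_herm (1 + ((1 + t ^ 2) / 4) • A⁻¹))
    (matRe_herm (1 + ((1 + t ^ 2) / 4) • B⁻¹)) (h1 A sA) (h1 B sB) (matRe_herm (1 + (A + B)⁻¹))
    (fun x => by rw [matRe_form]; exact sT.nonneg x)
    (fun x => by
      rw [hform, hform, matRe_form, Matrix.add_mulVec, dotProduct_add, Matrix.one_mulVec,
        Complex.add_re]
      have := sA.inv_add sB x
      linarith) hk1 hkn
  calc _ ≤ ∏ j ∈ Finset.univ.filter (fun j : Fin n => (j : ℕ) < k),
        (1 + t ^ 2) * lamS (matRe_herm (1 + (A + B)⁻¹)) j :=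
        Finset.prod_le_prod (fun i _ => Real.sqrt_nonneg _) (fun i _ => sT.sval_le i)
    _ = (1 + t ^ 2) ^ k * ∏ j ∈ Finset.univ.filter (fun j : Fin n => (j : ℕ) < k),
        lamS (matRe_herm (1 + (A + B)⁻¹)) j := by
        rw [Finset.prod_mul_distrib, Finset.prod_const, hcard]
    _ ≤ _ := by
        refine mul_le_mul_of_nonneg_left (key.trans ?_) (by positivity)
        refine mul_le_mul ?_ ?_ (Finset.prod_nonneg fun i _ => hlam0 B sB i)
          (Finset.prod_nonneg fun i _ => Real.sqrt_nonneg _)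
        · exact Finset.prod_le_prod (fun i _ => hlam0 A sA i) (fun i _ => lamS_le_sval _ i)
        · exact Finset.prod_le_prod (fun i _ => hlam0 B sB i) (fun i _ => lamS_le_sval _ i)
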